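/- arXiv:0806.3520 — 2 statements merged into one kernel-verified Lean document; each statement's English description precedes it below -/
import Mathlib

section
/- Every irreducible su(2) representation uplifts to a representation of the Nambu–Lie 3-algebra 𝒜₄ after a complex rescaling: let τ₁,τ₂,τ₃ be n×n complex matrices satisfying [τ_i,τ_j] = −i Σ_k ε_{ijk} τ_k and τ₁² + τ₂² + τ₃² = c·I with c ∈ ℂ, c ≠ 0, and let t ∈ ℂ satisfy t⁴ = −c. Then the matrices T_i := t^{−1} τ_i (i = 1,2,3) together with T₄ := t·I form an n×n matrix representation of 𝒜₄, i.e. [T_a,T_b,T_c]_N = i Σ_{d=1}^{4} ε_{abcd} T_d for all a,b,c ∈ {1,2,3,4}. -/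
/-- The Nambu commutator of three square complex matrices:
`[A,B,C]_N = ABC + BCA + CAB − BAC − ACB − CBA`. -/
noncomputable def nambu {n : ℕ} (A B C : Matrix (Fin n) (Fin n) ℂ) :
    Matrix (Fin n) (Fin n) ℂ :=
  A * B * C + B * C * A + C * A * B - B * A * C - A * C * B - C * B * A

/-- The totally antisymmetric tensor `ε_{abcd}` on four indices with
`ε_{1234} = +1` (indices `1,2,3,4` are represented by `0,1,2,3 : Fin 4`). -/
def eps4 (a b c d : Fin 4) : ℤ :=
  ∑ σ : Equiv.Perm (Fin 4),
    if σ 0 = a ∧ σ 1 = b ∧ σ 2 = c ∧ σ 3 = d then (Equiv.Perm.sign σ : ℤ) else 0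

/-- The totally antisymmetric tensor `ε_{ijk}` on three indices with
`ε_{123} = +1` (indices `1,2,3` are represented by `0,1,2 : Fin 3`). -/
def eps3 (i j k : Fin 3) : ℤ :=
  ∑ σ : Equiv.Perm (Fin 3),
    if σ 0 = i ∧ σ 1 = j ∧ σ 2 = k then (Equiv.Perm.sign σ : ℤ) else 0

theorem nambu_swap_left {n : ℕ} (A B C : Matrix (Fin n) (Fin n) ℂ) :
    nambu B A C = -nambu A B C := by
  unfold nambu; abel

theorem nambu_swap_right {n : ℕ} (A B C : Matrix (Fin n) (Fin n) ℂ) :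
    nambu A C B = -nambu A B C := by
  unfold nambu; abel

theorem nambu_self_left {n : ℕ} (A C : Matrix (Fin n) (Fin n) ℂ) : nambu A A C = 0 := by
  unfold nambu; abel

theorem nambu_smul {n : ℕ} (x y z : ℂ) (A B C : Matrix (Fin n) (Fin n) ℂ) :
    nambu (x • A) (y • B) (z • C) = (x * y * z) • nambu A B C := by
  simp only [nambu, smul_mul_assoc, mul_smul_comm, smul_smul, smul_add, smul_sub]
  ring_nf

theorem nambu_one_right {n : ℕ} (A B : Matrix (Fin n) (Fin n) ℂ) :
    nambu A B 1 = A * B - B * A := by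
  simp only [nambu, mul_one, one_mul]; abel

theorem nambu_eq_mul_commutator {n : ℕ} (A B C : Matrix (Fin n) (Fin n) ℂ) :
    nambu A B C = A * (B * C - C * B) + B * (C * A - A * C) + C * (A * B - B * A) := by
  unfold nambu; noncomm_ring

theorem eps4_swap_left (a b c d : Fin 4) : eps4 b a c d = -eps4 a b c d := by
  revert a b c d; decide +kernel

theorem eps4_swap_right (a b c d : Fin 4) : eps4 a c b d = -eps4 a b c d := by
  revert a b c d; decide +kernel

/-- A property of three indices that is invariant under transpositions and holds when the first
two indices coincide only has to be checked on increasing triples. -/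
theorem forall_of_swap_of_lt {α : Type*} [LinearOrder α] {P : α → α → α → Prop}
    (left : ∀ a b c, P a b c → P b a c) (right : ∀ a b c, P a b c → P a c b)
    (self : ∀ a c, P a a c) (lt : ∀ a b c, a < b → b < c → P a b c) (a b c : α) : P a b c := by
  rcases lt_trichotomy a b with hab | hab | hab <;>
  rcases lt_trichotomy b c with hbc | hbc | hbc <;>
  rcases lt_trichotomy a c with hac | hac | hac <;> grind

/-- Every irreducible su(2) representation uplifts to a representation of `𝒜₄`
after a complex rescaling: if `τ₁,τ₂,τ₃` satisfy `[τ_i,τ_j] = −i Σ_k ε_{ijk} τ_k`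
and `τ₁² + τ₂² + τ₃² = c·I` with `c ≠ 0`, and `t⁴ = −c`, then the matrices
`T_i := t⁻¹ τ_i` together with `T₄ := t·I` form a matrix representation of
`𝒜₄`. -/
theorem su2_uplift_to_A4_rep (n : ℕ) (τ : Fin 3 → Matrix (Fin n) (Fin n) ℂ)
    (hcomm : ∀ i j : Fin 3,
      τ i * τ j - τ j * τ i = (-Complex.I) • ∑ k, (eps3 i j k : ℂ) • τ k)
    (c : ℂ) (hc : c ≠ 0)
    (hcas : τ 0 * τ 0 + τ 1 * τ 1 + τ 2 * τ 2 = c • 1)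
    (t : ℂ) (ht : t ^ 4 = -c)
    (T : Fin 4 → Matrix (Fin n) (Fin n) ℂ)
    (hT : ∀ i : Fin 3, T i.castSucc = t⁻¹ • τ i)
    (hT4 : T 3 = t • 1) :
    ∀ a b c' : Fin 4,
      nambu (T a) (T b) (T c') = Complex.I • ∑ d, (eps4 a b c' d : ℂ) • T d := by
  have ht0 : t ≠ 0 := by
    rintro rfl
    exact hc (by simpa using ht)
  have h0 : T 0 = t⁻¹ • τ 0 := hT 0
  have h1 : T 1 = t⁻¹ • τ 1 := hT 1
  have h2 : T 2 = t⁻¹ • τ 2 := hT 2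
  have c01 : τ 0 * τ 1 - τ 1 * τ 0 = (-Complex.I) • τ 2 := by
    rw [hcomm, Fin.sum_univ_three, show eps3 0 1 0 = 0 by decide,
      show eps3 0 1 1 = 0 by decide, show eps3 0 1 2 = 1 by decide]
    simp
  have c12 : τ 1 * τ 2 - τ 2 * τ 1 = (-Complex.I) • τ 0 := by
    rw [hcomm, Fin.sum_univ_three, show eps3 1 2 0 = 1 by decide,
      show eps3 1 2 1 = 0 by decide, show eps3 1 2 2 = 0 by decide]
    simp
  have c20 : τ 2 * τ 0 - τ 0 * τ 2 = (-Complex.I) • τ 1 := by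
    rw [hcomm, Fin.sum_univ_three, show eps3 2 0 0 = 0 by decide,
      show eps3 2 0 1 = 1 by decide, show eps3 2 0 2 = 0 by decide]
    simp
  have c02 : τ 0 * τ 2 - τ 2 * τ 0 = Complex.I • τ 1 := by
    rw [← neg_sub, c20, neg_smul, neg_neg]
  have hs : t⁻¹ * t⁻¹ * t = t⁻¹ := by field_simp
  refine forall_of_swap_of_lt (fun a b c' h => ?_) (fun a b c' h => ?_) (fun a c' => ?_) ?_
  · rw [nambu_swap_left, h]
    simp [eps4_swap_left a b]
  · rw [nambu_swap_right, h]
    simp [eps4_swap_right a b]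
  · have h (d : Fin 4) : eps4 a a c' d = 0 := by
      have := eps4_swap_left a a c' d
      omega
    simp [nambu_self_left, h]
  · intro a b c' hab hbc
    have cases : (a = 0 ∧ b = 1 ∧ c' = 2) ∨ (a = 0 ∧ b = 1 ∧ c' = 3) ∨
        (a = 0 ∧ b = 2 ∧ c' = 3) ∨ (a = 1 ∧ b = 2 ∧ c' = 3) := by
      omega
    rcases cases with ⟨rfl, rfl, rfl⟩ | ⟨rfl, rfl, rfl⟩ | ⟨rfl, rfl, rfl⟩ | ⟨rfl, rfl, rfl⟩
    · have hcas' : nambu (τ 0) (τ 1) (τ 2) = (-Complex.I * c) • 1 := by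
        rw [nambu_eq_mul_commutator, c01, c12, c20, mul_smul, ← hcas]
        simp only [mul_smul_comm, smul_add]
      rw [h0, h1, h2, nambu_smul, hcas', Fin.sum_univ_four, show eps4 0 1 2 0 = 0 by decide,
        show eps4 0 1 2 1 = 0 by decide, show eps4 0 1 2 2 = 0 by decide,
        show eps4 0 1 2 3 = 1 by decide, hT4]
      simp only [Int.cast_zero, zero_smul, zero_add, Int.cast_one, smul_smul]
      congr 1
      field_simp
      linear_combination -ht
    · rw [h0, h1, hT4, nambu_smul, nambu_one_right, c01, hs, Fin.sum_univ_four,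
        show eps4 0 1 3 0 = 0 by decide, show eps4 0 1 3 1 = 0 by decide,
        show eps4 0 1 3 2 = -1 by decide, show eps4 0 1 3 3 = 0 by decide, h2]
      simp [smul_comm t⁻¹ Complex.I]
    · rw [h0, h2, hT4, nambu_smul, nambu_one_right, c02, hs, Fin.sum_univ_four,
        show eps4 0 2 3 0 = 0 by decide, show eps4 0 2 3 1 = 1 by decide,
        show eps4 0 2 3 2 = 0 by decide, show eps4 0 2 3 3 = 0 by decide, h1]
      simp [smul_comm t⁻¹ Complex.I]
    · rw [h1, h2, hT4, nambu_smul, nambu_one_right, c12, hs, Fin.sum_univ_four,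
        show eps4 1 2 3 0 = -1 by decide, show eps4 1 2 3 1 = 0 by decide,
        show eps4 1 2 3 2 = 0 by decide, show eps4 1 2 3 3 = 0 by decide, h0]
      simp [smul_comm t⁻¹ Complex.I]
end

section
/- Schur-type lemma for 3-algebra representations: let T₁,T₂,T₃,T₄ be an n×n matrix representation of the Nambu–Lie 3-algebra 𝒜₄ with T₄ = t·I scalar, t ≠ 0, and suppose the underlying representation is irreducible in the sense that every n×n complex matrix commuting with each of T₁, T₂, T₃ is a scalar multiple of the identity. Then the only matrix X satisfying [T_a, T_b, X]_N = 0 for all a,b ∈ {1,2,3,4} is X = 0. In particular, an irreducible representation of the 3-algebra has no nonzero central elements and hence no analogue of a Casimir operator. -/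
theorem nambu_smul_one {n : ℕ} (A B : Matrix (Fin n) (Fin n) ℂ) (c : ℂ) :
    nambu A B (c • 1) = c • (A * B - B * A) := by
  simp only [nambu, mul_smul_comm, smul_mul_assoc, mul_one, one_mul, smul_sub]
  abel

theorem nambu_smul_one_middle {n : ℕ} (A B : Matrix (Fin n) (Fin n) ℂ) (c : ℂ) :
    nambu A (c • 1) B = c • (B * A - A * B) := by
  simp only [nambu, mul_smul_comm, smul_mul_assoc, mul_one, one_mul, smul_sub]
  abel

theorem nambu_eq_zero_of_commute {n : ℕ} {A B C : Matrix (Fin n) (Fin n) ℂ}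
    (hAB : A * B = B * A) (hBC : B * C = C * B) (hAC : A * C = C * A) :
    nambu A B C = 0 := by
  rw [nambu, ← hAB, ← hAC, mul_assoc B C A, ← hAC, ← mul_assoc B A C, ← hAB, ← hBC,
    mul_assoc B C A, ← hAC, ← mul_assoc B A C, ← hAB]
  abel

theorem sum_eps4_zero_one_two {n : ℕ} (T : Fin 4 → Matrix (Fin n) (Fin n) ℂ) :
    ∑ d, (eps4 0 1 2 d : ℂ) • T d = T 3 := by
  have h0 : eps4 0 1 2 0 = 0 := by decide
  have h1 : eps4 0 1 2 1 = 0 := by decide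
  have h2 : eps4 0 1 2 2 = 0 := by decide
  have h3 : eps4 0 1 2 3 = 1 := by decide
  simp [Fin.sum_univ_four, h0, h1, h2, h3]

/-- Schur-type lemma for 3-algebra representations: if `T₁,T₂,T₃,T₄` is an
`n×n` matrix representation of `𝒜₄` with `T₄ = t·I` scalar, `t ≠ 0`, whose
underlying representation is irreducible (every matrix commuting with
`T₁,T₂,T₃` is scalar), then the only matrix `X` Nambu-commuting with all pairs
`T_a, T_b` is `X = 0`; i.e., an irreducible representation of the 3-algebra
has no nonzero central elements. -/
theorem A4_rep_schur (n : ℕ) (T : Fin 4 → Matrix (Fin n) (Fin n) ℂ)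
    (hrep : ∀ a b c : Fin 4,
      nambu (T a) (T b) (T c) = Complex.I • ∑ d, (eps4 a b c d : ℂ) • T d)
    (t : ℂ) (ht : t ≠ 0)
    (hT4 : T 3 = t • 1)
    (hirr : ∀ Y : Matrix (Fin n) (Fin n) ℂ,
      (∀ i : Fin 3, Y * T i.castSucc = T i.castSucc * Y) →
        ∃ c : ℂ, Y = c • 1)
    (X : Matrix (Fin n) (Fin n) ℂ)
    (hX : ∀ a b : Fin 4, nambu (T a) (T b) X = 0) :
    X = 0 := by
  have hcomm : ∀ a, X * T a = T a * X := fun a => by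
    have h := hX a 3
    rw [hT4, nambu_smul_one_middle] at h
    exact sub_eq_zero.mp ((smul_eq_zero.mp h).resolve_left ht)
  obtain ⟨c, rfl⟩ := hirr X fun i => hcomm i.castSucc
  by_cases hc : c = 0
  · rw [hc, zero_smul]
  have hTT : ∀ a b, T a * T b = T b * T a := fun a b => by
    have h := hX a b
    rw [nambu_smul_one] at h
    exact sub_eq_zero.mp ((smul_eq_zero.mp h).resolve_left hc)
  have h := hrep 0 1 2
  rw [nambu_eq_zero_of_commute (hTT 0 1) (hTT 1 2) (hTT 0 2), sum_eps4_zero_one_two, hT4] at h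
  have hone := (smul_eq_zero.mp ((smul_eq_zero.mp h.symm).resolve_left Complex.I_ne_zero)).resolve_left ht
  rw [hone, smul_zero]
end
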